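/- arXiv:2109.07688 — 5 statements merged into one kernel-verified Lean document; each statement's English description precedes it below -/
import Mathlib

section
/- Let A, B, C ∈ ℝ² be affinely independent points, let T = convexHull{A,B,C} be the closed triangle they span, and let e = [A,B] (the segment from A to B) be one of its edges. Let k ∈ ℕ and let v : ℝ² → ℝ be the function given by a real polynomial in two variables of total degree at most k. Then ∫_e v² dH¹ ≤ (1/2)·(k+1)(k+2)·(|e|/|T|)·∫_T v² dλ, where H¹ denotes one-dimensional Hausdorff measure on ℝ², |e| = ‖B − A‖ is the length of e, λ is two-dimensional Lebesgue measure, and |T| = λ(T) > 0 is the area of T. -/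
open MeasureTheory

namespace Polynomial

/-- Evaluation at `r` of an iterated derivative of `(X - r) ^ k * q`, in terms of the Taylor
coefficients of `q` at `r`. -/
lemma eval_iterate_derivative_add_X_sub_C_pow_mul {R : Type*} [CommRing R] (r : R) (q : R[X])
    (k i : ℕ) :
    (derivative^[k + i] ((X - C r) ^ k * q)).eval r =
      ((k + i).factorial : R) * (taylor r q).coeff i := by
  have h : taylor r ((X - C r) ^ k * q) = X ^ k * taylor r q := by
    simp [taylor_mul, taylor_pow]
  rw [← factorial_smul_hasseDeriv, LinearMap.smul_apply, eval_smul, ← taylor_coeff, h, add_comm k i,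
    coeff_X_pow_mul, nsmul_eq_mul]

lemma coeff_taylor_one_X_pow {R : Type*} [CommRing R] (n i : ℕ) :
    (taylor 1 (X ^ n : R[X])).coeff i = (n.choose i : R) := by
  simp [taylor_pow, ← coeff_X_add_one_pow R n i]

lemma eval_iterate_derivative_eq_zero_of_pow_dvd {R : Type*} [CommRing R] {p : R[X]} {r : R}
    {n m : ℕ} (h : (X - C r) ^ n ∣ p) (hm : m < n) : (derivative^[m] p).eval r = 0 :=
  dvd_iff_isRoot.1 <| (dvd_pow_self _ (Nat.sub_ne_zero_of_lt hm)).trans <|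
    pow_sub_dvd_iterate_derivative_of_pow_dvd m h

lemma integral_derivative_mul (p q : ℝ[X]) (a b : ℝ) :
    ∫ x in a..b, (derivative p).eval x * q.eval x =
      p.eval b * q.eval b - p.eval a * q.eval a -
        ∫ x in a..b, p.eval x * (derivative q).eval x := by
  have h := intervalIntegral.integral_mul_deriv_eq_deriv_mul (a := a) (b := b)
    (fun x _ ↦ q.hasDerivAt x) (fun x _ ↦ p.hasDerivAt x)
    (q.derivative.continuous.intervalIntegrable a b)
    (p.derivative.continuous.intervalIntegrable a b)
  simpa only [mul_comm] using h

/-- Repeated integration by parts when the boundary terms vanish. -/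
lemma integral_iterate_derivative_mul {p : ℝ[X]} {a b : ℝ} {m : ℕ}
    (ha : (X - C a) ^ m ∣ p) (hb : (X - C b) ^ m ∣ p) (q : ℝ[X]) :
    ∫ x in a..b, (derivative^[m] p).eval x * q.eval x =
      (-1) ^ m * ∫ x in a..b, p.eval x * (derivative^[m] q).eval x := by
  suffices ∀ i ≤ m, ∀ q : ℝ[X], ∫ x in a..b, (derivative^[i] p).eval x * q.eval x =
      (-1) ^ i * ∫ x in a..b, p.eval x * (derivative^[i] q).eval x from this m le_rfl q
  intro i
  induction i with
  | zero => simp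
  | succ i ih =>
    intro hi q
    rw [Function.iterate_succ_apply', integral_derivative_mul,
      eval_iterate_derivative_eq_zero_of_pow_dvd ha hi,
      eval_iterate_derivative_eq_zero_of_pow_dvd hb hi, ih (by lia), Function.iterate_succ_apply]
    ring

/-- The reproducing kernel of evaluation at `1` for polynomials of degree at most `k` with respect
to the weight `r` on `[0, 1]`, together with its value at `1`. -/
lemma exists_reproducing_kernel_eval_one (k : ℕ) :
    ∃ K : ℝ[X], K.natDegree ≤ k ∧ K.eval 1 = (k + 1) * (k + 2) ∧
      ∀ g : ℝ[X], g.natDegree ≤ k → ∫ r in (0 : ℝ)..1, r * (K.eval r * g.eval r) = g.eval 1 := by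
  set W : ℝ[X] := (X - C 1) ^ k * X ^ (k + 2) with hW
  have hW0 : (X - C 0) ^ (k + 2) ∣ W := by simp [hW]
  have hW1 : (X - C 1) ^ k ∣ W := dvd_mul_right _ _
  have hk : (k.factorial : ℝ) ≠ 0 := by positivity
  obtain ⟨Q, hQ⟩ : X ∣ derivative^[k + 1] W := by
    have := pow_sub_dvd_iterate_derivative_of_pow_dvd (k + 1) hW0
    rwa [show k + 2 - (k + 1) = 1 by lia, pow_one, C_0, sub_zero] at this
  have hdeg : Q.natDegree ≤ k := by
    rcases eq_or_ne Q 0 with rfl | hQ0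
    · simp
    have h1 := natDegree_iterate_derivative W (k + 1)
    have h2 : W.natDegree ≤ k + (k + 2) := by
      rw [hW]
      compute_degree
    rw [hQ, natDegree_X_mul hQ0] at h1
    lia
  refine ⟨C (k.factorial : ℝ)⁻¹ * Q, (natDegree_C_mul_le _ _).trans hdeg, ?_, fun g hg ↦ ?_⟩
  · have h := eval_iterate_derivative_add_X_sub_C_pow_mul (1 : ℝ) (X ^ (k + 2)) k 1
    rw [coeff_taylor_one_X_pow, ← hW, hQ, eval_mul, eval_X, one_mul, Nat.choose_one_right,
      Nat.factorial_succ] at h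
    rw [eval_mul, eval_C, h]
    push_cast
    field_simp
  · have h0 : (derivative^[k] W).eval 0 = 0 :=
      eval_iterate_derivative_eq_zero_of_pow_dvd hW0 (by lia)
    have h1 : (derivative^[k] W).eval 1 = k.factorial := by
      have h := eval_iterate_derivative_add_X_sub_C_pow_mul (1 : ℝ) (X ^ (k + 2)) k 0
      rwa [coeff_taylor_one_X_pow, ← hW, Nat.choose_zero_right, Nat.cast_one, mul_one] at h
    have hg' : derivative^[k] (derivative g) = 0 := by
      rw [← Function.iterate_succ_apply]
      exact iterate_derivative_eq_zero (by lia)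
    have h := integral_derivative_mul (derivative^[k] W) g 0 1
    rw [integral_iterate_derivative_mul ((pow_dvd_pow _ (by lia)).trans hW0) hW1, hg', h0, h1,
      ← Function.iterate_succ_apply' derivative, hQ] at h
    simp only [eval_mul, eval_X, eval_zero, mul_zero, zero_mul, sub_zero,
      intervalIntegral.integral_zero] at h
    calc ∫ r in (0 : ℝ)..1, r * ((C (k.factorial : ℝ)⁻¹ * Q).eval r * g.eval r)
        = ∫ r in (0 : ℝ)..1, (k.factorial : ℝ)⁻¹ * (r * Q.eval r * g.eval r) := by
          congr! 2 with r
          rw [eval_mul, eval_C]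
          ring
      _ = g.eval 1 := by
          rw [intervalIntegral.integral_const_mul, h]
          field_simp

/-- The sharp weighted trace inequality at an endpoint of `[0, 1]`. -/
lemma sq_eval_one_le_integral {g : ℝ[X]} {k : ℕ} (hg : g.natDegree ≤ k) :
    g.eval 1 ^ 2 ≤ (k + 1) * (k + 2) * ∫ r in (0 : ℝ)..1, r * g.eval r ^ 2 := by
  obtain ⟨K, hK, hK1, hrep⟩ := exists_reproducing_kernel_eval_one k
  set M : ℝ := (k + 1) * (k + 2) with hM
  have hMpos : 0 < M := by positivity
  have hnonneg : 0 ≤ ∫ r in (0 : ℝ)..1, r * (M * g.eval r - g.eval 1 * K.eval r) ^ 2 :=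
    intervalIntegral.integral_nonneg zero_le_one fun r hr ↦ mul_nonneg hr.1 (sq_nonneg _)
  have hexp : ∫ r in (0 : ℝ)..1, r * (M * g.eval r - g.eval 1 * K.eval r) ^ 2 =
      M ^ 2 * (∫ r in (0 : ℝ)..1, r * g.eval r ^ 2) -
        2 * M * g.eval 1 * (∫ r in (0 : ℝ)..1, r * (K.eval r * g.eval r)) +
        g.eval 1 ^ 2 * ∫ r in (0 : ℝ)..1, r * (K.eval r * K.eval r) := by
    simp only [← intervalIntegral.integral_const_mul]
    rw [← intervalIntegral.integral_sub, ← intervalIntegral.integral_add]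
    · congr! 2 with r
      ring
    all_goals exact Continuous.intervalIntegrable (by fun_prop) _ _
  rw [hexp, hrep g hg, hrep K hK, hK1] at hnonneg
  have : 0 ≤ M * (M * (∫ r in (0 : ℝ)..1, r * g.eval r ^ 2) - g.eval 1 ^ 2) := by linarith
  linarith [nonneg_of_mul_nonneg_right this hMpos]

end Polynomial

/-- The integral over a nondegenerate segment with respect to one-dimensional Hausdorff measure,
computed in the affine parametrization. -/
lemma setIntegral_segment_hausdorffMeasure {E F : Type*} [NormedAddCommGroup E] [NormedSpace ℝ E]
    [MeasurableSpace E] [BorelSpace E] [NormedAddCommGroup F] [NormedSpace ℝ F] {a b : E}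
    (hab : a ≠ b) (f : E → F) :
    ∫ x in segment ℝ a b, f x ∂μH[1] =
      ‖b - a‖ • ∫ t in (0 : ℝ)..1, f (AffineMap.lineMap a b t) := by
  have hinj : Function.Injective (AffineMap.lineMap a b : ℝ → E) :=
    AffineMap.lineMap_injective ℝ hab
  have hemb : MeasurableEmbedding (AffineMap.lineMap a b : ℝ → E) :=
    AffineMap.lineMap_continuous.measurableEmbedding hinj
  have hmeas : (μH[1] : Measure E).restrict (segment ℝ a b) =
      ‖b - a‖₊ • (volume.restrict (Set.Icc (0 : ℝ) 1)).map (AffineMap.lineMap a b) := by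
    ext s hs
    rw [Measure.smul_apply, Measure.map_apply hemb.measurable hs,
      Measure.restrict_apply (hemb.measurable hs), Measure.restrict_apply hs,
      segment_eq_image_lineMap, Set.inter_comm s, ← Set.image_inter_preimage,
      Set.inter_comm, hausdorffMeasure_lineMap_image, hausdorffMeasure_real, nndist_eq_nnnorm,
      ← nnnorm_neg, neg_sub]
  rw [hmeas, integral_smul_nnreal_measure, hemb.integral_map, integral_Icc_eq_integral_Ioc,
    intervalIntegral.integral_of_le zero_le_one]
  rfl

/-- The cross product of the edges `c - a` and `c - b`, i.e. twice the signed area. -/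
noncomputable def triangleDet (a b c : ℝ × ℝ) : ℝ :=
  (b.1 - a.1) * (a.2 - c.2) - (b.2 - a.2) * (a.1 - c.1)

/-- The collapsed parametrization of the triangle `abc` by the unit square, which contracts the
side `r = 0` to the vertex `c`. -/
noncomputable def duffyMap (a b c : ℝ × ℝ) (p : ℝ × ℝ) : ℝ × ℝ :=
  AffineMap.lineMap c (AffineMap.lineMap a b p.1) p.2

lemma duffyMap_eq (a b c p : ℝ × ℝ) :
    duffyMap a b c p = (c.1 + p.2 * (a.1 - c.1 + p.1 * (b.1 - a.1)),
      c.2 + p.2 * (a.2 - c.2 + p.1 * (b.2 - a.2))) := by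
  ext <;> simp [duffyMap, AffineMap.lineMap_apply] <;> ring

lemma hasFDerivAt_duffyMap (a b c p : ℝ × ℝ) :
    HasFDerivAt (duffyMap a b c) (Matrix.toLin (Module.Basis.finTwoProd ℝ)
      (Module.Basis.finTwoProd ℝ)
      !![p.2 * (b.1 - a.1), a.1 - c.1 + p.1 * (b.1 - a.1);
        p.2 * (b.2 - a.2), a.2 - c.2 + p.1 * (b.2 - a.2)]).toContinuousLinearMap p := by
  rw [Matrix.toLin_finTwoProd_toContinuousLinearMap, funext (duffyMap_eq a b c)]
  have h1 : HasFDerivAt (fun p : ℝ × ℝ ↦ p.1) (ContinuousLinearMap.fst ℝ ℝ ℝ) p := hasFDerivAt_fst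
  have h2 : HasFDerivAt (fun p : ℝ × ℝ ↦ p.2) (ContinuousLinearMap.snd ℝ ℝ ℝ) p := hasFDerivAt_snd
  have key (u v w : ℝ) : HasFDerivAt (fun p : ℝ × ℝ ↦ u + p.2 * (v + p.1 * w))
      ((p.2 * w) • ContinuousLinearMap.fst ℝ ℝ ℝ + (v + p.1 * w) • ContinuousLinearMap.snd ℝ ℝ ℝ)
      p := by
    refine ((h2.mul ((h1.mul_const w).const_add v)).const_add u).congr_fderiv ?_
    ext <;> simp
  exact (key _ _ _).prodMk (key _ _ _)

lemma duffyMap_image {a b c : ℝ × ℝ} (h : triangleDet a b c ≠ 0) :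
    duffyMap a b c '' (Set.Icc 0 1 ×ˢ Set.Ioc 0 1) = convexHull ℝ {a, b, c} \ {c} := by
  ext z
  rw [← convexJoin_segment_singleton, Set.mem_sdiff, mem_convexJoin]
  simp only [Set.mem_singleton_iff, exists_eq_left, segment_symm ℝ _ c]
  constructor
  · rintro ⟨⟨x, r⟩, ⟨hx, hr⟩, rfl⟩
    refine ⟨⟨AffineMap.lineMap a b x, ?_, ?_⟩, fun hc ↦ ?_⟩
    · exact segment_eq_image_lineMap ℝ a b ▸ Set.mem_image_of_mem _ hx
    · exact segment_eq_image_lineMap ℝ c _ ▸ Set.mem_image_of_mem _ ⟨hr.1.le, hr.2⟩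
    · rw [duffyMap_eq, Prod.ext_iff] at hc
      obtain ⟨h1, h2⟩ := hc
      refine mul_ne_zero hr.1.ne' h ?_
      unfold triangleDet
      linear_combination (b.1 - a.1) * h2 - (b.2 - a.2) * h1
  · rintro ⟨⟨w, hw, hz⟩, hzc⟩
    rw [segment_eq_image_lineMap] at hw hz
    obtain ⟨x, hx, rfl⟩ := hw
    obtain ⟨r, hr, rfl⟩ := hz
    refine ⟨(x, r), ⟨hx, hr.1.lt_of_ne' fun hr0 ↦ hzc ?_, hr.2⟩, rfl⟩
    rw [hr0, AffineMap.lineMap_apply_zero]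

lemma injOn_duffyMap {a b c : ℝ × ℝ} (h : triangleDet a b c ≠ 0) :
    Set.InjOn (duffyMap a b c) (Set.Icc 0 1 ×ˢ Set.Ioc 0 1) := by
  rintro ⟨x, r⟩ ⟨-, hr⟩ ⟨y, s⟩ - hxy
  simp only [duffyMap_eq, Prod.mk.injEq] at hxy
  obtain ⟨h1, h2⟩ := hxy
  have hr0 : r ≠ 0 := hr.1.ne'
  unfold triangleDet at h
  have hrs : r = s := by
    apply mul_right_cancel₀ h
    linear_combination (b.1 - a.1) * h2 - (b.2 - a.2) * h1
  subst hrs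
  have hxy : r * x = r * y := by
    apply mul_right_cancel₀ h
    linear_combination (a.2 - c.2) * h1 - (a.1 - c.1) * h2
  rw [mul_left_cancel₀ hr0 hxy]

/-- Integration over a triangle in collapsed coordinates. -/
lemma setIntegral_convexHull_triple_prod {a b c : ℝ × ℝ} (h : triangleDet a b c ≠ 0)
    {f : ℝ × ℝ → ℝ} (hf : Continuous f) :
    ∫ z in convexHull ℝ {a, b, c}, f z = |triangleDet a b c| *
      ∫ x in (0 : ℝ)..1, ∫ r in (0 : ℝ)..1,
        r * f (AffineMap.lineMap c (AffineMap.lineMap a b x) r) := by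
  have hae : (convexHull ℝ {a, b, c} \ {c} : Set (ℝ × ℝ)) =ᵐ[volume] convexHull ℝ {a, b, c} :=
    sdiff_null_ae_eq_self (measure_singleton c)
  have hdet (p : ℝ × ℝ) : ((Matrix.toLin (Module.Basis.finTwoProd ℝ) (Module.Basis.finTwoProd ℝ)
      !![p.2 * (b.1 - a.1), a.1 - c.1 + p.1 * (b.1 - a.1);
        p.2 * (b.2 - a.2), a.2 - c.2 + p.1 * (b.2 - a.2)]).toContinuousLinearMap).det =
      p.2 * triangleDet a b c := by
    simp only [ContinuousLinearMap.det, LinearMap.coe_toContinuousLinearMap, LinearMap.det_toLin,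
      Matrix.det_fin_two_of, triangleDet]
    ring
  have hcont : Continuous fun p : ℝ × ℝ ↦ |p.2 * triangleDet a b c| * f (duffyMap a b c p) := by
    simp only [duffyMap_eq]
    fun_prop
  rw [← setIntegral_congr_set hae, ← duffyMap_image h,
    integral_image_eq_integral_abs_det_fderiv_smul volume (measurableSet_Icc.prod measurableSet_Ioc)
      (fun p _ ↦ (hasFDerivAt_duffyMap a b c p).hasFDerivWithinAt) (injOn_duffyMap h)]
  simp only [hdet, smul_eq_mul]
  rw [Measure.volume_eq_prod, setIntegral_prod]
  · rw [integral_Icc_eq_integral_Ioc, intervalIntegral.integral_of_le zero_le_one,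
      ← integral_const_mul]
    congr! 2 with x
    rw [intervalIntegral.integral_of_le zero_le_one, ← integral_const_mul]
    refine setIntegral_congr_fun measurableSet_Ioc fun r hr ↦ ?_
    simp only [abs_mul, abs_of_pos hr.1, duffyMap]
    ring
  · exact (hcont.continuousOn.integrableOn_compact (isCompact_Icc.prod isCompact_Icc)).mono_set
      (Set.prod_mono_right Set.Ioc_subset_Icc_self)

/-- The coordinates of a point of the Euclidean plane, as a linear equivalence. -/
noncomputable def euclideanPlaneEquiv : EuclideanSpace ℝ (Fin 2) ≃L[ℝ] ℝ × ℝ :=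
  (EuclideanSpace.equiv (Fin 2) ℝ).trans (ContinuousLinearEquiv.finTwoArrow ℝ ℝ)

lemma euclideanPlaneEquiv_apply (x : EuclideanSpace ℝ (Fin 2)) :
    euclideanPlaneEquiv x = (x 0, x 1) := rfl

lemma measurePreserving_euclideanPlaneEquiv : MeasurePreserving euclideanPlaneEquiv :=
  (volume_preserving_finTwoArrow ℝ).comp (PiLp.volume_preserving_ofLp (Fin 2))

/-- Integration over a triangle of the Euclidean plane in collapsed coordinates. -/
lemma setIntegral_convexHull_triple {a b c : EuclideanSpace ℝ (Fin 2)}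
    (h : triangleDet (euclideanPlaneEquiv a) (euclideanPlaneEquiv b) (euclideanPlaneEquiv c) ≠ 0)
    {f : EuclideanSpace ℝ (Fin 2) → ℝ} (hf : Continuous f) :
    ∫ z in convexHull ℝ {a, b, c}, f z =
      |triangleDet (euclideanPlaneEquiv a) (euclideanPlaneEquiv b) (euclideanPlaneEquiv c)| *
        ∫ x in (0 : ℝ)..1, ∫ r in (0 : ℝ)..1,
          r * f (AffineMap.lineMap c (AffineMap.lineMap a b x) r) := by
  have him : euclideanPlaneEquiv '' convexHull ℝ {a, b, c} = convexHull ℝ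
      {euclideanPlaneEquiv a, euclideanPlaneEquiv b, euclideanPlaneEquiv c} := by
    have := euclideanPlaneEquiv.toLinearMap.image_convexHull {a, b, c}
    simpa [Set.image_insert_eq] using this
  have hsymm (x r : ℝ) : euclideanPlaneEquiv.symm (AffineMap.lineMap (euclideanPlaneEquiv c)
      (AffineMap.lineMap (euclideanPlaneEquiv a) (euclideanPlaneEquiv b) x) r) =
      AffineMap.lineMap c (AffineMap.lineMap a b x) r := by
    simp [AffineMap.lineMap_apply]
  have := measurePreserving_euclideanPlaneEquiv.setIntegral_image_emb
    euclideanPlaneEquiv.toHomeomorph.measurableEmbedding (fun z ↦ f (euclideanPlaneEquiv.symm z))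
    (convexHull ℝ {a, b, c})
  simp only [ContinuousLinearEquiv.symm_apply_apply] at this
  rw [← this, him, setIntegral_convexHull_triple_prod h (by fun_prop)]
  simp only [hsymm]

lemma volume_convexHull_triple {a b c : EuclideanSpace ℝ (Fin 2)}
    (h : triangleDet (euclideanPlaneEquiv a) (euclideanPlaneEquiv b) (euclideanPlaneEquiv c) ≠ 0) :
    (volume (convexHull ℝ {a, b, c})).toReal =
      |triangleDet (euclideanPlaneEquiv a) (euclideanPlaneEquiv b) (euclideanPlaneEquiv c)| / 2 := by
  have := setIntegral_convexHull_triple h (f := fun _ ↦ 1) continuous_const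
  rw [setIntegral_const] at this
  simp only [smul_eq_mul, mul_one, integral_id, intervalIntegral.integral_const] at this
  rw [← measureReal_def, this]
  norm_num
  ring

lemma triangleDet_ne_zero {a b c : EuclideanSpace ℝ (Fin 2)} (h : AffineIndependent ℝ ![a, b, c]) :
    triangleDet (euclideanPlaneEquiv a) (euclideanPlaneEquiv b) (euclideanPlaneEquiv c) ≠ 0 := by
  intro h0
  simp only [triangleDet, euclideanPlaneEquiv_apply] at h0
  rw [affineIndependent_iff_not_collinear_set] at h
  have hab : a ≠ b := by
    rintro rfl
    exact h (by simpa using collinear_pair ℝ a c)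
  refine h ((collinear_iff_of_mem (p₀ := a) (by simp)).2 ?_)
  have hcoord : b 0 - a 0 ≠ 0 ∨ b 1 - a 1 ≠ 0 := by
    by_contra! hc
    refine hab (PiLp.ext fun i ↦ ?_)
    fin_cases i
    · simpa using (sub_eq_zero.1 hc.1).symm
    · simpa using (sub_eq_zero.1 hc.2).symm
  have key (t : ℝ) (ht0 : c 0 - a 0 = t * (b 0 - a 0)) (ht1 : c 1 - a 1 = t * (b 1 - a 1)) :
      ∃ v : EuclideanSpace ℝ (Fin 2), ∀ p ∈ ({a, b, c} : Set _), ∃ r : ℝ, p = r • v +ᵥ a := by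
    refine ⟨b - a, ?_⟩
    rintro p (rfl | rfl | rfl)
    · exact ⟨0, by simp⟩
    · exact ⟨1, by simp⟩
    · refine ⟨t, PiLp.ext fun i ↦ ?_⟩
      fin_cases i
      · simp [← ht0]
      · simp [← ht1]
  rcases hcoord with hc | hc
  · refine key ((c 0 - a 0) / (b 0 - a 0)) (by field_simp) ?_
    field_simp
    linear_combination -h0
  · refine key ((c 1 - a 1) / (b 1 - a 1)) ?_ (by field_simp)
    field_simp
    linear_combination h0

/-- The restriction of a polynomial in several variables to a parametrized line is a polynomial
whose degree is bounded by the total degree. -/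
lemma MvPolynomial.exists_natDegree_le_eval_lineMap {ι : Type*} [Fintype ι] {k : ℕ}
    {P : MvPolynomial ι ℝ} (hP : P.totalDegree ≤ k) (a b : EuclideanSpace ℝ ι) :
    ∃ g : Polynomial ℝ, g.natDegree ≤ k ∧
      ∀ r : ℝ, g.eval r = eval (fun i ↦ (AffineMap.lineMap a b r : EuclideanSpace ℝ ι) i) P := by
  refine ⟨aeval (fun i ↦ Polynomial.C (b i - a i) * Polynomial.X + Polynomial.C (a i)) P, ?_,
    fun r ↦ ?_⟩
  · exact (aeval_natDegree_le P hP _ fun i ↦ Polynomial.natDegree_linear_le).trans_eq (mul_one k)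
  · rw [← Polynomial.coe_aeval_eq_eval, comp_aeval_apply, ← coe_aeval_eq_eval, RingHom.coe_coe]
    congr! 2 with i
    simp [AffineMap.lineMap_apply, mul_comm]

/-- The paper's Lemma 2.2 (Warburton–Hesthaven trace-inverse inequality): for a
nondegenerate triangle `T = conv{A,B,C}` with edge `e = [A,B]` and a polynomial `v` of
total degree at most `k`,
`∫_e v² dH¹ ≤ (1/2)·(k+1)(k+2)·(|e|/|T|)·∫_T v² dλ`. -/
theorem trace_inverse_inequality
    (A B C : EuclideanSpace ℝ (Fin 2))
    (hABC : AffineIndependent ℝ ![A, B, C])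
    (k : ℕ) (P : MvPolynomial (Fin 2) ℝ) (hP : P.totalDegree ≤ k)
    (v : EuclideanSpace ℝ (Fin 2) → ℝ)
    (hv : ∀ x, v x = MvPolynomial.eval (fun i => x i) P) :
    ∫ x in segment ℝ A B, v x ^ 2 ∂(μH[1]) ≤
      (1 / 2 : ℝ) * (k + 1) * (k + 2) *
        (‖B - A‖ / (volume (convexHull ℝ {A, B, C})).toReal) *
        ∫ x in convexHull ℝ {A, B, C}, v x ^ 2 := by
  have hdet := triangleDet_ne_zero hABC
  have hvcont : Continuous v := by
    rw [funext hv]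
    exact (MvPolynomial.continuous_eval P).comp (by fun_prop)
  have hAB : A ≠ B := fun h ↦ absurd (hABC.injective (a₁ := 0) (a₂ := 1) h) (by decide)
  rw [setIntegral_segment_hausdorffMeasure hAB, volume_convexHull_triple hdet,
    setIntegral_convexHull_triple hdet (f := fun x ↦ v x ^ 2) (hvcont.pow 2), smul_eq_mul]
  have hline (x : ℝ) : v (AffineMap.lineMap A B x) ^ 2 ≤ (k + 1) * (k + 2) *
      ∫ r in (0 : ℝ)..1, r * v (AffineMap.lineMap C (AffineMap.lineMap A B x) r) ^ 2 := by
    obtain ⟨g, hg, hgv⟩ := MvPolynomial.exists_natDegree_le_eval_lineMap hP C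
      (AffineMap.lineMap A B x)
    simpa [hgv, ← hv] using Polynomial.sq_eval_one_le_integral hg
  have hcont : Continuous fun x : ℝ ↦ ∫ r in (0 : ℝ)..1,
      r * v (AffineMap.lineMap C (AffineMap.lineMap A B x) r) ^ 2 := by
    refine intervalIntegral.continuous_parametric_intervalIntegral_of_continuous' ?_ 0 1
    simp only [Function.uncurry_def, AffineMap.lineMap_apply]
    fun_prop
  have hcont' : Continuous fun x : ℝ ↦ v (AffineMap.lineMap A B x) ^ 2 :=
    (hvcont.comp AffineMap.lineMap_continuous).pow 2
  have hmono := intervalIntegral.integral_mono (μ := volume) zero_le_one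
    (hcont'.intervalIntegrable 0 1)
    ((hcont.const_mul (((k : ℝ) + 1) * (k + 2))).intervalIntegrable 0 1) hline
  rw [intervalIntegral.integral_const_mul] at hmono
  refine (mul_le_mul_of_nonneg_left hmono (norm_nonneg (B - A))).trans_eq ?_
  have := abs_ne_zero.2 hdet
  field_simp
end

section
/- Abstract form of the paper's Theorem 3.1 (discrete inf-sup/well-posedness for the saddle-point form). Assume hypothesis (H): there is a constant C_sup > 0 such that for every v ∈ V there exists τ ∈ Σ with ⟪D τ, v⟫ = ‖v‖² and |||τ||| ≤ C_sup·‖v‖. Then there exists α > 0 depending only on C_sup (independent of Σ, V, a, D) such that for every (σ,u) ∈ Σ × V there exists (τ,v) ∈ Σ × V with N(τ,v) ≤ N(σ,u) and B[(σ,u),(τ,v)] ≥ α·N(σ,u)². In particular, α·N(σ,u) ≤ sup over (τ,v) with N(τ,v) ≠ 0 of B[(σ,u),(τ,v)]/N(τ,v). -/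
open RealInnerProductSpace

/-- The seminorm induced by a positive-semidefinite bilinear form: `‖τ‖_a = √(a(τ,τ))`. -/
noncomputable def aNorm {E : Type*} [NormedAddCommGroup E] [InnerProductSpace ℝ E]
    (a : E →ₗ[ℝ] E →ₗ[ℝ] ℝ) (τ : E) : ℝ := Real.sqrt (a τ τ)

/-- `|||τ|||² = ‖τ‖_a² + ‖D τ‖²`. -/
noncomputable def tNorm {E V : Type*} [NormedAddCommGroup E] [InnerProductSpace ℝ E]
    [NormedAddCommGroup V] [InnerProductSpace ℝ V]
    (a : E →ₗ[ℝ] E →ₗ[ℝ] ℝ) (D : E →ₗ[ℝ] V) (τ : E) : ℝ :=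
  Real.sqrt (aNorm a τ ^ 2 + ‖D τ‖ ^ 2)

/-- `N(τ,v)² = |||τ|||² + ‖v‖²`. -/
noncomputable def NNorm {E V : Type*} [NormedAddCommGroup E] [InnerProductSpace ℝ E]
    [NormedAddCommGroup V] [InnerProductSpace ℝ V]
    (a : E →ₗ[ℝ] E →ₗ[ℝ] ℝ) (D : E →ₗ[ℝ] V) (τ : E) (v : V) : ℝ :=
  Real.sqrt (tNorm a D τ ^ 2 + ‖v‖ ^ 2)

/-- The saddle-point form `B[(σ,u),(τ,v)] = a(σ,τ) − ⟪u, D τ⟫ − ⟪v, D σ⟫`. -/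
noncomputable def BForm {E V : Type*} [NormedAddCommGroup E] [InnerProductSpace ℝ E]
    [NormedAddCommGroup V] [InnerProductSpace ℝ V]
    (a : E →ₗ[ℝ] E →ₗ[ℝ] ℝ) (D : E →ₗ[ℝ] V) (σ : E) (u : V) (τ : E) (v : V) : ℝ :=
  a σ τ - ⟪u, D τ⟫ - ⟪v, D σ⟫

theorem tNorm_sq {E V : Type*} [NormedAddCommGroup E] [InnerProductSpace ℝ E]
    [NormedAddCommGroup V] [InnerProductSpace ℝ V] {a : E →ₗ[ℝ] E →ₗ[ℝ] ℝ}
    (ha : ∀ τ, 0 ≤ a τ τ) (D : E →ₗ[ℝ] V) (τ : E) :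
    tNorm a D τ ^ 2 = a τ τ + ‖D τ‖ ^ 2 := by
  rw [tNorm, Real.sq_sqrt (by positivity), aNorm, Real.sq_sqrt (ha τ)]

theorem NNorm_sq {E V : Type*} [NormedAddCommGroup E] [InnerProductSpace ℝ E]
    [NormedAddCommGroup V] [InnerProductSpace ℝ V] {a : E →ₗ[ℝ] E →ₗ[ℝ] ℝ}
    (ha : ∀ τ, 0 ≤ a τ τ) (D : E →ₗ[ℝ] V) (τ : E) (v : V) :
    NNorm a D τ v ^ 2 = a τ τ + ‖D τ‖ ^ 2 + ‖v‖ ^ 2 := by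
  rw [NNorm, Real.sq_sqrt (by positivity), tNorm_sq ha]

theorem norm_add_sq_le_two_mul {V : Type*} [SeminormedAddCommGroup V] (x y : V) :
    ‖x + y‖ ^ 2 ≤ 2 * ‖x‖ ^ 2 + 2 * ‖y‖ ^ 2 := by
  have h := norm_add_le x y
  nlinarith [norm_nonneg (x + y), sq_nonneg (‖x‖ - ‖y‖)]

/-- Abstract form of the paper's Theorem 3.1: discrete inf-sup / well-posedness of the
saddle-point form, with a constant `α` depending only on `C_sup`. -/
theorem infsup_wellposedness (Csup : ℝ) (hCsup : 0 < Csup) :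
    ∃ α : ℝ, 0 < α ∧
      ∀ (E V : Type) [NormedAddCommGroup E] [InnerProductSpace ℝ E]
        [NormedAddCommGroup V] [InnerProductSpace ℝ V]
        (a : E →ₗ[ℝ] E →ₗ[ℝ] ℝ),
        (∀ σ τ : E, a σ τ = a τ σ) →
        (∀ τ : E, 0 ≤ a τ τ) →
        ∀ D : E →ₗ[ℝ] V,
        (∀ v : V, ∃ τ : E, ⟪D τ, v⟫ = ‖v‖ ^ 2 ∧ tNorm a D τ ≤ Csup * ‖v‖) →
        ∀ (σ : E) (u : V), ∃ (τ : E) (v : V),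
          NNorm a D τ v ≤ NNorm a D σ u ∧
          α * NNorm a D σ u ^ 2 ≤ BForm a D σ u τ v := by
  obtain ⟨δ, hδ, hδ1, hδC⟩ : ∃ δ : ℝ, 0 < δ ∧ δ ≤ 1 ∧ δ * Csup ^ 2 ≤ 1 := by
    refine ⟨(1 + Csup ^ 2)⁻¹, by positivity, inv_le_one_of_one_le₀ (by nlinarith), ?_⟩
    rw [inv_mul_le_iff₀ (by positivity)]
    linarith
  refine ⟨δ / 4, by positivity, ?_⟩
  intro E V _ _ _ _ a hsymm hpos D hD σ u
  obtain ⟨τ₀, hτ₀, hbound⟩ := hD u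
  have htest : a τ₀ τ₀ + ‖D τ₀‖ ^ 2 ≤ Csup ^ 2 * ‖u‖ ^ 2 := by
    rw [← tNorm_sq hpos, ← mul_pow]
    exact pow_le_pow_left₀ (Real.sqrt_nonneg _) hbound 2
  have hscaled : δ * (a τ₀ τ₀ + ‖D τ₀‖ ^ 2) ≤ ‖u‖ ^ 2 := by
    nlinarith [sq_nonneg ‖u‖]
  have hscaled_sq : δ ^ 2 * (a τ₀ τ₀ + ‖D τ₀‖ ^ 2) ≤ δ * ‖u‖ ^ 2 := by
    nlinarith
  have hδu : δ * ‖u‖ ^ 2 ≤ ‖u‖ ^ 2 := mul_le_of_le_one_left (sq_nonneg _) hδ1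
  refine ⟨(1 / 2 : ℝ) • (σ - δ • τ₀), (1 / 2 : ℝ) • (-u - D σ), ?_, ?_⟩
  · suffices h : NNorm a D _ _ ^ 2 ≤ NNorm a D σ u ^ 2 from
      (sq_le_sq₀ (Real.sqrt_nonneg _) (Real.sqrt_nonneg _)).mp h
    rw [NNorm_sq hpos, NNorm_sq hpos]
    have hDτ : ‖D σ - δ • D τ₀‖ ^ 2 ≤ 2 * ‖D σ‖ ^ 2 + 2 * (δ ^ 2 * ‖D τ₀‖ ^ 2) := by
      simpa [sub_eq_add_neg, norm_smul, mul_pow] using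
        norm_add_sq_le_two_mul (D σ) (-(δ • D τ₀))
    have hv : ‖-u - D σ‖ ^ 2 ≤ 2 * ‖u‖ ^ 2 + 2 * ‖D σ‖ ^ 2 := by
      simpa [sub_eq_add_neg] using norm_add_sq_le_two_mul (-u) (-D σ)
    have hcross := hpos (σ + δ • τ₀)
    simp only [map_add, map_sub, map_smul, LinearMap.add_apply, LinearMap.sub_apply,
      LinearMap.smul_apply, smul_eq_mul, norm_smul, mul_pow, hsymm τ₀ σ] at hcross ⊢
    norm_num
    linarith [hpos σ]
  · rw [NNorm_sq hpos]
    have hcross := hpos (σ - δ • τ₀)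
    have hDu : ⟪u, D τ₀⟫ = ‖u‖ ^ 2 := by rw [real_inner_comm, hτ₀]
    simp only [BForm, map_sub, map_smul, LinearMap.sub_apply, LinearMap.smul_apply,
      smul_eq_mul, inner_sub_left, inner_sub_right, inner_neg_left, real_inner_smul_left,
      real_inner_smul_right, real_inner_self_eq_norm_sq, hsymm τ₀ σ, hDu] at hcross ⊢
    nlinarith [mul_le_of_le_one_left (hpos σ) hδ1,
      mul_le_of_le_one_left (sq_nonneg ‖D σ‖) hδ1, mul_nonneg (sq_nonneg δ) (sq_nonneg ‖D τ₀‖)]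
end

section
/- Abstract form of the paper's Lemma 4.2 (stability via quasi-consistency). Assume hypothesis (H): there is a constant C_sup > 0 such that for every v ∈ V there exists τ ∈ Σ with ⟪D τ, v⟫ = ‖v‖² and |||τ||| ≤ C_sup·‖v‖. Then there exists α > 0 depending only on C_sup such that the following holds: if (σ,u) ∈ Σ × V, (σ_h,u_h) ∈ Σ × V, ε ≥ 0, and E : Σ → ℝ satisfy B[(σ_h,u_h),(τ,v)] = B[(σ,u),(τ,v)] + E(τ) for all (τ,v) ∈ Σ × V, with |E(τ)| ≤ ε·‖τ‖_a for all τ ∈ Σ, then α·N(σ_h,u_h) ≤ N(σ,u) + ε. -/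
open RealInnerProductSpace

lemma aNorm_sq {E : Type*} [NormedAddCommGroup E] [InnerProductSpace ℝ E]
    {a : E →ₗ[ℝ] E →ₗ[ℝ] ℝ} (hpos : ∀ τ : E, 0 ≤ a τ τ) (τ : E) : aNorm a τ ^ 2 = a τ τ :=
  Real.sq_sqrt (hpos τ)

/-- Cauchy-Schwarz for a positive-semidefinite symmetric form. -/
lemma abs_apply_le_aNorm_mul_aNorm {E : Type*} [NormedAddCommGroup E] [InnerProductSpace ℝ E]
    {a : E →ₗ[ℝ] E →ₗ[ℝ] ℝ} (hsymm : ∀ σ τ : E, a σ τ = a τ σ)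
    (hpos : ∀ τ : E, 0 ≤ a τ τ) (σ τ : E) : |a σ τ| ≤ aNorm a σ * aNorm a τ := by
  refine abs_le_of_sq_le_sq ?_ (mul_nonneg (Real.sqrt_nonneg _) (Real.sqrt_nonneg _))
  rw [mul_pow, aNorm_sq hpos, aNorm_sq hpos, sq]
  nth_rewrite 2 [hsymm]
  exact LinearMap.BilinForm.apply_mul_apply_le_of_forall_zero_le a hpos σ τ

lemma aNorm_add_le {E : Type*} [NormedAddCommGroup E] [InnerProductSpace ℝ E]
    {a : E →ₗ[ℝ] E →ₗ[ℝ] ℝ} (hsymm : ∀ σ τ : E, a σ τ = a τ σ)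
    (hpos : ∀ τ : E, 0 ≤ a τ τ) (σ τ : E) : aNorm a (σ + τ) ≤ aNorm a σ + aNorm a τ := by
  refine Real.sqrt_le_iff.2 ⟨add_nonneg (Real.sqrt_nonneg _) (Real.sqrt_nonneg _), ?_⟩
  have hcs := (abs_le.1 (abs_apply_le_aNorm_mul_aNorm hsymm hpos σ τ)).2
  rw [add_sq, aNorm_sq hpos, aNorm_sq hpos]
  simp only [map_add, LinearMap.add_apply, hsymm τ σ]
  linarith

lemma aNorm_le_tNorm {E V : Type*} [NormedAddCommGroup E] [InnerProductSpace ℝ E]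
    [NormedAddCommGroup V] [InnerProductSpace ℝ V]
    (a : E →ₗ[ℝ] E →ₗ[ℝ] ℝ) (D : E →ₗ[ℝ] V) (τ : E) : aNorm a τ ≤ tNorm a D τ :=
  Real.le_sqrt_of_sq_le (le_add_of_nonneg_right (sq_nonneg _))

lemma NNorm_eq_sqrt {E V : Type*} [NormedAddCommGroup E] [InnerProductSpace ℝ E]
    [NormedAddCommGroup V] [InnerProductSpace ℝ V]
    (a : E →ₗ[ℝ] E →ₗ[ℝ] ℝ) (D : E →ₗ[ℝ] V) (τ : E) (v : V) :
    NNorm a D τ v = √(aNorm a τ ^ 2 + ‖D τ‖ ^ 2 + ‖v‖ ^ 2) := by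
  rw [NNorm, tNorm, Real.sq_sqrt (by positivity)]

/-- Abstract form of the paper's Lemma 4.2 (stability via quasi-consistency), with a
constant `α` depending only on `C_sup`. -/
theorem stability_quasi_consistency (Csup : ℝ) (hCsup : 0 < Csup) :
    ∃ α : ℝ, 0 < α ∧
      ∀ (E V : Type) [NormedAddCommGroup E] [InnerProductSpace ℝ E]
        [NormedAddCommGroup V] [InnerProductSpace ℝ V]
        (a : E →ₗ[ℝ] E →ₗ[ℝ] ℝ),
        (∀ σ τ : E, a σ τ = a τ σ) →
        (∀ τ : E, 0 ≤ a τ τ) →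
        ∀ D : E →ₗ[ℝ] V,
        (∀ v : V, ∃ τ : E, ⟪D τ, v⟫ = ‖v‖ ^ 2 ∧ tNorm a D τ ≤ Csup * ‖v‖) →
        ∀ (σ : E) (u : V) (σh : E) (uh : V) (ε : ℝ) (Err : E → ℝ),
          0 ≤ ε →
          (∀ (τ : E) (v : V), BForm a D σh uh τ v = BForm a D σ u τ v + Err τ) →
          (∀ τ : E, |Err τ| ≤ ε * aNorm a τ) →
          α * NNorm a D σh uh ≤ NNorm a D σ u + ε := by
  refine ⟨1 / (3 + 2 * Csup), by positivity, ?_⟩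
  intro E V _ _ _ _ a hsymm hpos D hsup σ u σh uh ε Err hε hB hErr
  obtain ⟨s, rfl⟩ : ∃ s, σh = σ + s := ⟨σh - σ, by abel⟩
  obtain ⟨w, rfl⟩ : ∃ w, uh = u + w := ⟨uh - u, by abel⟩
  have hdiff : ∀ (τ : E) (v : V), a s τ - ⟪w, D τ⟫ - ⟪v, D s⟫ = Err τ := by
    intro τ v
    have h := hB τ v
    simp only [BForm, map_add, LinearMap.add_apply, inner_add_left, inner_add_right] at h
    linarith
  have hDs : D s = 0 := by
    have h₁ := hdiff 0 (D s)
    have h₂ := hdiff 0 0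
    rw [inner_zero_left] at h₂
    exact inner_self_eq_zero.1 (by linarith : ⟪D s, D s⟫ = 0)
  have herr : ∀ τ : E, a s τ - ⟪w, D τ⟫ = Err τ := by
    intro τ
    simpa using hdiff τ 0
  have hs : aNorm a s ≤ ε := by
    have h₁ := herr s
    rw [hDs, inner_zero_right, sub_zero, ← aNorm_sq hpos] at h₁
    have h₂ := (abs_le.1 (hErr s)).2
    have h₃ : 0 ≤ aNorm a s := Real.sqrt_nonneg _
    nlinarith
  have hw : ‖w‖ ≤ 2 * Csup * ε := by
    obtain ⟨τ, hτ, hτC⟩ := hsup w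
    have h₁ := herr τ
    rw [real_inner_comm, hτ] at h₁
    have h₂ := (abs_le.1 (hErr τ)).1
    have h₃ := (abs_le.1 (abs_apply_le_aNorm_mul_aNorm hsymm hpos s τ)).2
    have h₄ : aNorm a s * aNorm a τ ≤ ε * aNorm a τ :=
      mul_le_mul_of_nonneg_right hs (Real.sqrt_nonneg _)
    have h₅ := mul_le_mul_of_nonneg_left ((aNorm_le_tNorm a D τ).trans hτC) hε
    have h₆ : 0 ≤ 2 * Csup * ε := by positivity
    have h₇ : ‖w‖ * ‖w‖ ≤ 2 * Csup * ε * ‖w‖ := by linarith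
    rcases (norm_nonneg w).eq_or_lt with h | h
    · rwa [← h]
    · exact le_of_mul_le_mul_right h₇ h
  have hadd := aNorm_add_le hsymm hpos σ s
  have hu := norm_add_le u w
  have ha₀ : 0 ≤ aNorm a (σ + s) := Real.sqrt_nonneg _
  rw [div_mul_eq_mul_div, one_mul, div_le_iff₀ (by positivity), NNorm_eq_sqrt, NNorm_eq_sqrt,
    map_add, hDs, add_zero]
  set N := √(aNorm a σ ^ 2 + ‖D σ‖ ^ 2 + ‖u‖ ^ 2)
  have hN : 0 ≤ N := Real.sqrt_nonneg _
  have h₁ : aNorm a σ ≤ N := Real.le_sqrt_of_sq_le (by nlinarith [sq_nonneg ‖D σ‖])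
  have h₂ : ‖D σ‖ ≤ N := Real.le_sqrt_of_sq_le (by nlinarith [sq_nonneg (aNorm a σ)])
  have h₃ : ‖u‖ ≤ N := Real.le_sqrt_of_sq_le (by nlinarith [sq_nonneg (aNorm a σ)])
  have h₄ : √(aNorm a (σ + s) ^ 2 + ‖D σ‖ ^ 2 + ‖u + w‖ ^ 2)
      ≤ aNorm a (σ + s) + ‖D σ‖ + ‖u + w‖ := by
    refine Real.sqrt_le_iff.2 ⟨by positivity, ?_⟩
    have h₅ := mul_nonneg ha₀ (norm_nonneg (D σ))
    have h₆ := mul_nonneg ha₀ (norm_nonneg (u + w))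
    have h₇ := mul_nonneg (norm_nonneg (D σ)) (norm_nonneg (u + w))
    linarith
  have h₅ : 0 ≤ Csup * N := by positivity
  linarith
end

section
/- Abstract form of the paper's Theorem 5.3 (inf-sup for the Stokes saddle-point form with constant independent of the viscosity). Let ν > 0 and assume hypothesis (H_ν): there is a constant C_sup > 0 such that for every v ∈ V there exists τ ∈ Σ with ⟪D τ, v⟫ = ‖v‖² and |||τ|||_ν ≤ C_sup·ν^{-1/2}·‖v‖. Then there exists α > 0 depending only on C_sup — in particular independent of ν — such that for every (σ,u) ∈ Σ × V there exists (τ,v) ∈ Σ × V with N_ν(τ,v) ≤ N_ν(σ,u) and B_ν[(σ,u),(τ,v)] ≥ α·N_ν(σ,u)². -/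
open RealInnerProductSpace

/-- The viscosity-weighted norm `|||τ|||_ν² = ‖τ‖_a² + ν⁻¹·‖D τ‖²`. -/
noncomputable def tNormNu {E V : Type*} [NormedAddCommGroup E] [InnerProductSpace ℝ E]
    [NormedAddCommGroup V] [InnerProductSpace ℝ V]
    (a : E →ₗ[ℝ] E →ₗ[ℝ] ℝ) (D : E →ₗ[ℝ] V) (ν : ℝ) (τ : E) : ℝ :=
  Real.sqrt (aNorm a τ ^ 2 + ν⁻¹ * ‖D τ‖ ^ 2)

/-- The viscosity-weighted combined norm `N_ν(τ,v)² = |||τ|||_ν² + ν·‖v‖²`. -/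
noncomputable def NNormNu {E V : Type*} [NormedAddCommGroup E] [InnerProductSpace ℝ E]
    [NormedAddCommGroup V] [InnerProductSpace ℝ V]
    (a : E →ₗ[ℝ] E →ₗ[ℝ] ℝ) (D : E →ₗ[ℝ] V) (ν : ℝ) (τ : E) (v : V) : ℝ :=
  Real.sqrt (tNormNu a D ν τ ^ 2 + ν * ‖v‖ ^ 2)

/-- The Stokes saddle-point form `B_ν[(σ,u),(τ,v)] = a(σ,τ) + ⟪D τ, u⟫ + ⟪D σ, v⟫`. -/
noncomputable def BFormNu {E V : Type*} [NormedAddCommGroup E] [InnerProductSpace ℝ E]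
    [NormedAddCommGroup V] [InnerProductSpace ℝ V]
    (a : E →ₗ[ℝ] E →ₗ[ℝ] ℝ) (D : E →ₗ[ℝ] V) (σ : E) (u : V) (τ : E) (v : V) : ℝ :=
  a σ τ + ⟪D τ, u⟫ + ⟪D σ, v⟫

section

variable {E V : Type*} [NormedAddCommGroup E] [InnerProductSpace ℝ E]
  [NormedAddCommGroup V] [InnerProductSpace ℝ V]
  {a : E →ₗ[ℝ] E →ₗ[ℝ] ℝ}

theorem tNormNu_sq (ha : ∀ τ, 0 ≤ a τ τ) (D : E →ₗ[ℝ] V) {ν : ℝ} (hν : 0 < ν) (τ : E) :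
    tNormNu a D ν τ ^ 2 = a τ τ + ν⁻¹ * ‖D τ‖ ^ 2 := by
  rw [tNormNu, Real.sq_sqrt (by positivity), aNorm, Real.sq_sqrt (ha τ)]

theorem NNormNu_sq (ha : ∀ τ, 0 ≤ a τ τ) (D : E →ₗ[ℝ] V) {ν : ℝ} (hν : 0 < ν) (τ : E) (v : V) :
    NNormNu a D ν τ v ^ 2 = a τ τ + ν⁻¹ * ‖D τ‖ ^ 2 + ν * ‖v‖ ^ 2 := by
  rw [NNormNu, Real.sq_sqrt (by positivity), tNormNu_sq ha D hν]

theorem NNormNu_nonneg (D : E →ₗ[ℝ] V) (ν : ℝ) (τ : E) (v : V) : 0 ≤ NNormNu a D ν τ v :=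
  Real.sqrt_nonneg _

theorem NNormNu_smul_sq (ha : ∀ τ, 0 ≤ a τ τ) (D : E →ₗ[ℝ] V) {ν : ℝ} (hν : 0 < ν)
    (c : ℝ) (τ : E) (v : V) :
    NNormNu a D ν (c • τ) (c • v) ^ 2 = c ^ 2 * NNormNu a D ν τ v ^ 2 := by
  rw [NNormNu_sq ha D hν, NNormNu_sq ha D hν]
  simp only [map_smul, LinearMap.smul_apply, smul_eq_mul, norm_smul, mul_pow, Real.norm_eq_abs,
    sq_abs]
  ring

theorem NNormNu_add_sq_le (ha : ∀ τ, 0 ≤ a τ τ) (D : E →ₗ[ℝ] V) {ν : ℝ} (hν : 0 < ν)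
    (σ τ : E) (u v : V) :
    NNormNu a D ν (σ + τ) (u + v) ^ 2 ≤
      2 * NNormNu a D ν σ u ^ 2 + 2 * NNormNu a D ν τ v ^ 2 := by
  simp only [NNormNu_sq ha D hν]
  have h := ha (σ - τ)
  have hD : ‖D (σ + τ)‖ ^ 2 ≤ 2 * ‖D σ‖ ^ 2 + 2 * ‖D τ‖ ^ 2 := by
    rw [map_add]
    nlinarith [parallelogram_law_with_norm ℝ (D σ) (D τ), sq_nonneg ‖D σ - D τ‖]
  have hV : ‖u + v‖ ^ 2 ≤ 2 * ‖u‖ ^ 2 + 2 * ‖v‖ ^ 2 := by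
    nlinarith [parallelogram_law_with_norm ℝ u v, sq_nonneg ‖u - v‖]
  have hD' := mul_le_mul_of_nonneg_left hD (inv_pos.2 hν).le
  have hV' := mul_le_mul_of_nonneg_left hV hν.le
  simp only [map_add, map_sub, LinearMap.add_apply, LinearMap.sub_apply] at h hD' ⊢
  linarith

theorem BFormNu_smul (D : E →ₗ[ℝ] V) (σ : E) (u : V) (c : ℝ) (τ : E) (v : V) :
    BFormNu a D σ u (c • τ) (c • v) = c * BFormNu a D σ u τ v := by
  simp only [BFormNu, map_smul, smul_eq_mul, real_inner_smul_left, real_inner_smul_right]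
  ring

/-- The unscaled test pair `(σ + e, ν⁻¹ D σ - u)`, where `e` lifts a multiple of `u`. -/
theorem exists_test_pair (hsymm : ∀ σ τ, a σ τ = a τ σ) (ha : ∀ τ, 0 ≤ a τ τ)
    (D : E →ₗ[ℝ] V) {ν C : ℝ} (hν : 0 < ν) (hC : 0 < C) (u : V)
    (hH : ∃ τ : E, ⟪D τ, u⟫ = ‖u‖ ^ 2 ∧ tNormNu a D ν τ ≤ C * (Real.sqrt ν)⁻¹ * ‖u‖) (σ : E) :
    ∃ (τ : E) (v : V),
      NNormNu a D ν τ v ^ 2 ≤ (2 * (1 + C⁻¹) * NNormNu a D ν σ u) ^ 2 ∧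
      min 1 (C⁻¹ ^ 2) / 2 * NNormNu a D ν σ u ^ 2 ≤ BFormNu a D σ u τ v := by
  obtain ⟨ξ, hξ, hb⟩ := hH
  have hq : a ξ ξ + ν⁻¹ * ‖D ξ‖ ^ 2 ≤ C ^ 2 * ν⁻¹ * ‖u‖ ^ 2 := by
    rw [← tNormNu_sq ha D hν]
    refine (pow_le_pow_left₀ (Real.sqrt_nonneg _) hb 2).trans_eq ?_
    rw [mul_pow, mul_pow, inv_pow, Real.sq_sqrt hν.le]
  set t := C⁻¹ ^ 2 * ν with ht
  set e := t • ξ with he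
  have hDe : ⟪D e, u⟫ = C⁻¹ ^ 2 * (ν * ‖u‖ ^ 2) := by
    rw [he, map_smul, real_inner_smul_left, hξ, ht]
    ring
  have hqe : a e e + ν⁻¹ * ‖D e‖ ^ 2 ≤ C⁻¹ ^ 2 * (ν * ‖u‖ ^ 2) := by
    have h1 := mul_le_mul_of_nonneg_left hq (sq_nonneg t)
    have h2 : a e e + ν⁻¹ * ‖D e‖ ^ 2 = t ^ 2 * (a ξ ξ + ν⁻¹ * ‖D ξ‖ ^ 2) := by
      simp only [he, map_smul, LinearMap.smul_apply, smul_eq_mul, norm_smul, mul_pow,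
        Real.norm_eq_abs, sq_abs]
      ring
    have h3 : t ^ 2 * (C ^ 2 * ν⁻¹ * ‖u‖ ^ 2) = C⁻¹ ^ 2 * (ν * ‖u‖ ^ 2) := by
      rw [ht]
      field_simp
    linarith
  have hA := ha σ
  have hd : 0 ≤ ν⁻¹ * ‖D σ‖ ^ 2 := by positivity
  have hw : 0 ≤ ν * ‖u‖ ^ 2 := by positivity
  refine ⟨σ + e, -u + ν⁻¹ • D σ, ?_, ?_⟩
  · have h := NNormNu_add_sq_le ha D hν σ e (-u) (ν⁻¹ • D σ)
    have hs : ν * ‖ν⁻¹ • D σ‖ ^ 2 = ν⁻¹ * ‖D σ‖ ^ 2 := by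
      rw [norm_smul, mul_pow, Real.norm_eq_abs, sq_abs]
      field_simp
    rw [NNormNu_sq ha D hν σ, NNormNu_sq ha D hν e, norm_neg, hs] at h
    rw [mul_pow, NNormNu_sq ha D hν σ u]
    have hC' : 0 < C⁻¹ := inv_pos.2 hC
    nlinarith [mul_nonneg (sq_nonneg C⁻¹) hA, mul_nonneg (sq_nonneg C⁻¹) hd,
      mul_nonneg (sq_nonneg C⁻¹) hw, mul_nonneg hC'.le hA, mul_nonneg hC'.le hd,
      mul_nonneg hC'.le hw]
  · have hcs := ha (σ + e)
    have hde : 0 ≤ ν⁻¹ * ‖D e‖ ^ 2 := by positivity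
    have hB : BFormNu a D σ u (σ + e) (-u + ν⁻¹ • D σ) =
        a σ σ + a σ e + ⟪D e, u⟫ + ν⁻¹ * ‖D σ‖ ^ 2 := by
      simp only [BFormNu, map_add, inner_add_left, inner_add_right, inner_neg_right,
        real_inner_smul_right, real_inner_self_eq_norm_sq]
      ring
    simp only [map_add, LinearMap.add_apply, hsymm e σ] at hcs
    rw [hB, hDe, NNormNu_sq ha D hν]
    have m1 := min_le_left 1 (C⁻¹ ^ 2)
    have m2 := min_le_right 1 (C⁻¹ ^ 2)
    have k1 := mul_le_mul_of_nonneg_right m1 hA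
    have k2 := mul_le_mul_of_nonneg_right m1 hd
    have k3 := mul_le_mul_of_nonneg_right m2 hw
    linarith

end

/-- Abstract form of the paper's Theorem 5.3: inf-sup for the Stokes saddle-point form with
a constant `α` depending only on `C_sup`, in particular independent of the viscosity `ν`. -/
theorem stokes_infsup (Csup : ℝ) (hCsup : 0 < Csup) :
    ∃ α : ℝ, 0 < α ∧
      ∀ (E V : Type) [NormedAddCommGroup E] [InnerProductSpace ℝ E]
        [NormedAddCommGroup V] [InnerProductSpace ℝ V]
        (a : E →ₗ[ℝ] E →ₗ[ℝ] ℝ),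
        (∀ σ τ : E, a σ τ = a τ σ) →
        (∀ τ : E, 0 ≤ a τ τ) →
        ∀ (D : E →ₗ[ℝ] V) (ν : ℝ), 0 < ν →
        -- hypothesis (H_ν)
        (∀ v : V, ∃ τ : E, ⟪D τ, v⟫ = ‖v‖ ^ 2 ∧
            tNormNu a D ν τ ≤ Csup * (Real.sqrt ν)⁻¹ * ‖v‖) →
        ∀ (σ : E) (u : V), ∃ (τ : E) (v : V),
          NNormNu a D ν τ v ≤ NNormNu a D ν σ u ∧
          α * NNormNu a D ν σ u ^ 2 ≤ BFormNu a D σ u τ v := by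
  refine ⟨(2 * (1 + Csup⁻¹))⁻¹ * (min 1 (Csup⁻¹ ^ 2) / 2), by positivity, ?_⟩
  intro E V _ _ _ _ a hsymm ha D ν hν hH σ u
  obtain ⟨τ, v, hN, hB⟩ := exists_test_pair hsymm ha D hν hCsup u (hH u) σ
  have hK : 0 < 2 * (1 + Csup⁻¹) := by positivity
  refine ⟨(2 * (1 + Csup⁻¹))⁻¹ • τ, (2 * (1 + Csup⁻¹))⁻¹ • v, ?_, ?_⟩
  · refine (sq_le_sq₀ (NNormNu_nonneg D ν _ _) (NNormNu_nonneg D ν σ u)).1 ?_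
    rw [NNormNu_smul_sq ha D hν, inv_pow, inv_mul_le_iff₀ (by positivity), ← mul_pow]
    exact hN
  · rw [BFormNu_smul, mul_assoc]
    exact mul_le_mul_of_nonneg_left hB (inv_pos.2 hK).le
end

section
/- Abstract form of the paper's Lemma 5.1 (equivalence of the theoretical scheme on the trace-free subspace and the practical Lagrange-multiplier scheme). Let Σ and V be real vector spaces, B : (Σ × V) × (Σ × V) → ℝ a bilinear form, φ : Σ → ℝ a linear functional, ι ∈ Σ with φ(ι) ≠ 0, G : Σ → ℝ and F : V → ℝ linear functionals, and ν > 0. Assume: (i) G(ι) = 0, and (ii) B[(σ,u),(ι,0)] = 0 for all (σ,u) ∈ Σ × V. Then for (σ,u,λ) ∈ Σ × V × ℝ the following are equivalent: (a) φ(σ) = 0 and B[(σ,u),(τ,v)] + (λ/ν)·φ(τ) = G(τ) + F(v) for all (τ,v) ∈ Σ × V; (b) λ = 0, φ(σ) = 0, and B[(σ,u),(τ,v)] = G(τ) + F(v) for all (τ,v) ∈ (ker φ) × V. -/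
/-- Abstract form of the paper's Lemma 5.1: equivalence of the theoretical scheme posed on
the trace-free subspace `ker φ` and the practical Lagrange-multiplier scheme. -/
theorem theoretical_practical_equivalence
    {E V : Type*} [AddCommGroup E] [Module ℝ E] [AddCommGroup V] [Module ℝ V]
    (B : (E × V) →ₗ[ℝ] (E × V) →ₗ[ℝ] ℝ)
    (φ : E →ₗ[ℝ] ℝ) (ι : E) (hι : φ ι ≠ 0)
    (G : E →ₗ[ℝ] ℝ) (F : V →ₗ[ℝ] ℝ)
    (ν : ℝ) (hν : 0 < ν)
    (hG : G ι = 0)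
    (hB : ∀ (σ : E) (u : V), B (σ, u) (ι, 0) = 0)
    (σ : E) (u : V) (lam : ℝ) :
    (φ σ = 0 ∧
      ∀ (τ : E) (v : V), B (σ, u) (τ, v) + (lam / ν) * φ τ = G τ + F v) ↔
    (lam = 0 ∧ φ σ = 0 ∧
      ∀ τ ∈ LinearMap.ker φ, ∀ v : V, B (σ, u) (τ, v) = G τ + F v) := by
  constructor
  · rintro ⟨hσ, h⟩
    have hlam : lam = 0 := by
      have h_test := h ι 0
      rw [hB, hG, map_zero, zero_add, add_zero] at h_test
      simpa [hι, hν.ne'] using h_test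
    refine ⟨hlam, hσ, fun τ hτ v => ?_⟩
    simpa [hlam] using h τ v
  · rintro ⟨rfl, hσ, h⟩
    refine ⟨hσ, fun τ v => ?_⟩
    set c : ℝ := φ τ / φ ι
    have hker : τ - c • ι ∈ LinearMap.ker φ := by
      simp [c, hι]
    have hsplit : ((τ, v) : E × V) = (τ - c • ι, v) + c • (ι, 0) := by
      simp
    rw [hsplit, map_add, map_smul, hB, h _ hker v]
    simp [hG]
end
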